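/- Let M ≥ 1 be a natural number, κ > 0 a real, and α ∈ (0,1). The central rejection level of the chi-squared quantile pooled p-value chipool(·;κ) satisfies sSup {p ∈ (0,1) : chipool((p,…,p); κ) ≤ α} = 1 − F_χ( (1/M) · F_χ⁻¹(1 − α; Mκ); κ ). -/

import Mathlib

open Set Filter Topology

/-- `F_χ(·;κ)`: the CDF of the chi-squared distribution with real degrees of
freedom `κ`, i.e. of the Gamma distribution with shape `κ/2` and rate `1/2`. -/
noncomputable def chiSqCDF (κ : ℝ) : ℝ → ℝ :=
  fun x => ProbabilityTheory.cdf (ProbabilityTheory.gammaMeasure (κ / 2) (1 / 2)) x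

/-- `F_χ⁻¹(q;κ)`: the quantile function of the chi-squared distribution. -/
noncomputable def chiSqInv (κ : ℝ) (q : ℝ) : ℝ := sInf {x : ℝ | q ≤ chiSqCDF κ x}

theorem continuous_chiSqCDF {κ : ℝ} (hκ : 0 < κ) : Continuous (chiSqCDF κ) := by
  have := ProbabilityTheory.isProbabilityMeasure_gammaMeasure (half_pos hκ) (one_half_pos (α := ℝ))
  rw [continuous_iff_continuousAt]
  intro x
  unfold chiSqCDF
  set F := ProbabilityTheory.cdf (ProbabilityTheory.gammaMeasure (κ / 2) (1 / 2)) with hF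
  have h0 : F.measure {x} = 0 := by
    rw [hF, ProbabilityTheory.measure_cdf, ProbabilityTheory.gammaMeasure]
    exact MeasureTheory.withDensity_absolutelyContinuous _ _ (by simp)
  rw [StieltjesFunction.measure_singleton, ENNReal.ofReal_eq_zero] at h0
  rw [F.mono.continuousAt_iff_leftLim_eq_rightLim, F.rightLim_eq]
  exact le_antisymm (F.mono.leftLim_le le_rfl) (by linarith)

theorem chiSqCDF_zero {κ : ℝ} (hκ : 0 < κ) : chiSqCDF κ 0 = 0 := by
  rw [chiSqCDF, ProbabilityTheory.cdf_gammaMeasure_eq_lintegral (half_pos hκ) one_half_pos,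
    ← MeasureTheory.setLIntegral_congr MeasureTheory.Iio_ae_eq_Iic,
    ProbabilityTheory.lintegral_gammaPDF_of_nonpos le_rfl, ENNReal.toReal_zero]

theorem monotone_chiSqCDF (κ : ℝ) : Monotone (chiSqCDF κ) :=
  ProbabilityTheory.monotone_cdf _

theorem strictMonoOn_chiSqCDF {κ : ℝ} (hκ : 0 < κ) : StrictMonoOn (chiSqCDF κ) (Ici 0) := by
  have := ProbabilityTheory.isProbabilityMeasure_gammaMeasure (half_pos hκ) (one_half_pos (α := ℝ))
  intro x hx y _ hxy
  by_contra! hle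
  have h0 : (ProbabilityTheory.cdf
      (ProbabilityTheory.gammaMeasure (κ / 2) (1 / 2))).measure (Ioc x y) = 0 := by
    rw [StieltjesFunction.measure_Ioc]
    exact ENNReal.ofReal_of_nonpos (sub_nonpos.2 hle)
  rw [ProbabilityTheory.measure_cdf, ProbabilityTheory.gammaMeasure,
    MeasureTheory.withDensity_apply_eq_zero (f := ProbabilityTheory.gammaPDF (κ / 2) (1 / 2))
      (ProbabilityTheory.measurable_gammaPDFReal _ _).ennreal_ofReal] at h0
  have h1 : MeasureTheory.volume (Ioc x y) = 0 := by
    refine MeasureTheory.measure_mono_null (subset_inter (fun z hz => ?_) Subset.rfl) h0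
    exact (ENNReal.ofReal_pos.2 (ProbabilityTheory.gammaPDFReal_pos (half_pos hκ) one_half_pos
      (lt_of_le_of_lt hx hz.1))).ne'
  rw [Real.volume_Ioc, ENNReal.ofReal_eq_zero] at h1
  linarith

theorem chiSqCDF_mem_Ioo {κ x : ℝ} (hκ : 0 < κ) (hx : 0 < x) :
    chiSqCDF κ x ∈ Ioo (0 : ℝ) 1 := by
  constructor
  · rw [← chiSqCDF_zero hκ]
    exact strictMonoOn_chiSqCDF hκ self_mem_Ici hx.le hx
  · exact (strictMonoOn_chiSqCDF hκ hx.le (by simp; linarith) (lt_add_one x)).trans_le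
      (ProbabilityTheory.cdf_le_one _ _)

theorem exists_pos_chiSqCDF_eq {κ q : ℝ} (hκ : 0 < κ) (hq : q ∈ Ioo (0 : ℝ) 1) :
    ∃ x, 0 < x ∧ chiSqCDF κ x = q := by
  obtain ⟨b, hb⟩ : ∃ b, q < chiSqCDF κ b :=
    ((ProbabilityTheory.tendsto_cdf_atTop _).eventually (lt_mem_nhds hq.2)).exists
  obtain ⟨x, hx⟩ := mem_range_of_exists_le_of_exists_ge (continuous_chiSqCDF hκ)
    ⟨0, (chiSqCDF_zero hκ).trans_le hq.1.le⟩ ⟨b, hb.le⟩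
  refine ⟨x, ?_, hx⟩
  by_contra! h
  have := monotone_chiSqCDF κ h
  rw [chiSqCDF_zero hκ, hx] at this
  exact this.not_gt hq.1

theorem chiSqInv_chiSqCDF {κ x : ℝ} (hκ : 0 < κ) (hx : 0 < x) :
    chiSqInv κ (chiSqCDF κ x) = x := by
  refine IsLeast.csInf_eq ⟨le_refl (chiSqCDF κ x), fun y hy => ?_⟩
  by_contra! hyx
  have hlt : chiSqCDF κ (max y 0) < chiSqCDF κ x :=
    strictMonoOn_chiSqCDF hκ (le_max_right y 0) hx.le (max_lt hyx hx)
  exact (hlt.trans_le (le_trans hy (monotone_chiSqCDF κ (le_max_left y 0)))).false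

/-- For `M ≥ 1`, `κ > 0` and `α ∈ (0,1)`, the central rejection
level of the chi-squared quantile pooled p-value satisfies
`sSup {p ∈ (0,1) : chipool((p,…,p);κ) ≤ α} = 1 − F_χ((1/M)·F_χ⁻¹(1 − α; Mκ); κ)`. -/
theorem chiPool_central_rejection
    (M : ℕ) (hM : 1 ≤ M) (κ : ℝ) (hκ : 0 < κ) (α : ℝ) (hα : α ∈ Set.Ioo (0 : ℝ) 1) :
    sSup {p : ℝ | p ∈ Set.Ioo (0 : ℝ) 1 ∧
        1 - chiSqCDF ((M : ℝ) * κ) (∑ _i : Fin M, chiSqInv κ (1 - p)) ≤ α}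
      = 1 - chiSqCDF κ ((1 / (M : ℝ)) * chiSqInv ((M : ℝ) * κ) (1 - α)) := by
  have hM0 : (0 : ℝ) < M := by exact_mod_cast hM
  have hMκ : 0 < (M : ℝ) * κ := mul_pos hM0 hκ
  obtain ⟨y, hy, hyα⟩ := exists_pos_chiSqCDF_eq hMκ (q := 1 - α)
    ⟨by linarith [hα.2], by linarith [hα.1]⟩
  rw [← hyα, chiSqInv_chiSqCDF hMκ hy]
  have ht : 0 < 1 / (M : ℝ) * y := by positivity
  simp only [Finset.sum_const, Finset.card_univ, Fintype.card_fin, nsmul_eq_mul]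
  refine IsGreatest.csSup_eq ⟨⟨?_, ?_⟩, ?_⟩
  · have h := chiSqCDF_mem_Ioo hκ ht
    exact ⟨by linarith [h.2], by linarith [h.1]⟩
  · rw [sub_sub_cancel, chiSqInv_chiSqCDF hκ ht, ← mul_assoc, mul_one_div_cancel hM0.ne', one_mul,
      hyα]
    linarith
  · rintro p ⟨hp, hle⟩
    obtain ⟨x, hx, hxp⟩ := exists_pos_chiSqCDF_eq hκ (q := 1 - p)
      ⟨by linarith [hp.2], by linarith [hp.1]⟩
    rw [← hxp, chiSqInv_chiSqCDF hκ hx] at hle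
    have hyx : y ≤ M * x := by
      refine ((strictMonoOn_chiSqCDF hMκ).le_iff_le hy.le (mul_pos hM0 hx).le).1 ?_
      linarith
    have htx : 1 / (M : ℝ) * y ≤ x := by
      rw [one_div_mul_eq_div, div_le_iff₀' hM0]
      exact hyx
    linarith [monotone_chiSqCDF κ htx]
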